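/- In the category of simplicial sets, the enlargement construction yields: given a based simplicial set $(E,e)$, a based simplicial subset $(D,e)$ with inclusion $\alpha : D \to E$, and a conical contraction $\psi : CD \to D$, the pushout $\overline{E}$ of $\psi$ along $C\alpha : CD \to CE$ carries an induced conical contraction $\overline{\psi} : C\overline{E} \to \overline{E}$, and the composite $\beta : E \xrightarrow{\eta} CE \to \overline{E}$ is injective in each degree. -/

import Mathlib

/-- A based simplicial set: a simplicial set together with a base point (a simplicial
point, i.e. a family of simplices preserved by all operators). -/
structure BSSet where
  X : ℕ → Type
  pt : ∀ n, X n
  d : ℕ → ∀ n, X (n + 1) → X n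
  s : ℕ → ∀ n, X n → X (n + 1)
  d_pt : ∀ j n, d j n (pt (n + 1)) = pt n
  s_pt : ∀ j n, s j n (pt n) = pt (n + 1)
  dd : ∀ i j n, i < j → j ≤ n + 2 → ∀ x : X (n + 2),
    d i n (d j (n + 1) x) = d (j - 1) n (d i (n + 1) x)
  ss : ∀ i j n, i ≤ j → j ≤ n → ∀ x : X n,
    s i (n + 1) (s j n x) = s (j + 1) (n + 1) (s i n x)
  ds_lt : ∀ i j n, i < j → j ≤ n + 1 → ∀ x : X (n + 1),
    d i (n + 1) (s j (n + 1) x) = s (j - 1) n (d i n x)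
  ds_eq : ∀ j n, j ≤ n → ∀ x : X n, d j n (s j n x) = x
  ds_succ : ∀ j n, j ≤ n → ∀ x : X n, d (j + 1) n (s j n x) = x
  ds_gt : ∀ i j n, j + 1 < i → i ≤ n + 2 → ∀ x : X (n + 1),
    d i (n + 1) (s j (n + 1) x) = s j n (d (i - 1) n x)

/-- A based simplicial map between based simplicial sets. -/
structure BMap (A B : BSSet) where
  f : ∀ n, A.X n → B.X n
  f_pt : ∀ n, f n (A.pt n) = B.pt n
  f_d : ∀ j n, j ≤ n + 1 → ∀ x, f n (A.d j n x) = B.d j n (f (n + 1) x)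
  f_s : ∀ j n, j ≤ n → ∀ x, f (n + 1) (A.s j n x) = B.s j n (f n x)

section Cone

variable (X : ℕ → Type)

/-- The set of `n`-simplices of the unreduced simplicial cone `ĈX`:
`(ĈX)ₙ = Xₙ(0) ∪ ⋯ ∪ X₀(n) ∪ X₋₁(n+1)`.  Here `none` is the formal point `(o, n+1)` of
dimension `-1`, and `some ⟨i, x⟩` is the pair `(x, i)` with `x` of dimension `n - i`. -/
def hatC (n : ℕ) : Type := Option ((i : Fin (n + 1)) × X (n - (i : ℕ)))

variable (dX : ℕ → ∀ n, X (n + 1) → X n) (sX : ℕ → ∀ n, X n → X (n + 1))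

/-- Face operators of the unreduced cone: `d_j(x,i) = (d_jx, i)` if `j ≤ dim x`
(where a `0`-dimensional `x` has `d₀x = o`, the formal point) and `d_j(x,i) = (x, i-1)`
if `j > dim x`. -/
def hatD (j n : ℕ) : hatC X (n + 1) → hatC X n
  | none => none
  | some ⟨i, x⟩ =>
      if h1 : j ≤ n + 1 - (i : ℕ) then
        if h2 : (i : ℕ) ≤ n then
          some ⟨⟨i, by omega⟩, dX j (n - (i : ℕ))
            (cast (congrArg X (by omega : n + 1 - (i : ℕ) = n - (i : ℕ) + 1)) x)⟩
        else none
      else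
        if h3 : 1 ≤ (i : ℕ) then
          some ⟨⟨(i : ℕ) - 1, by have := i.isLt; omega⟩,
            cast (congrArg X (by omega : n + 1 - (i : ℕ) = n - ((i : ℕ) - 1))) x⟩
        else none

/-- Degeneracy operators of the unreduced cone: `s_j(x,i) = (s_jx, i)` if `j ≤ dim x`
and `s_j(x,i) = (x, i+1)` if `j > dim x`. -/
def hatS (j n : ℕ) : hatC X n → hatC X (n + 1)
  | none => none
  | some ⟨i, x⟩ =>
      if h1 : j ≤ n - (i : ℕ) then
        some ⟨⟨i, by have := i.isLt; omega⟩,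
          cast (congrArg X (by have := i.isLt; omega : n - (i : ℕ) + 1 = n + 1 - (i : ℕ)))
            (sX j (n - (i : ℕ)) x)⟩
      else
        some ⟨⟨(i : ℕ) + 1, by have := i.isLt; omega⟩,
          cast (congrArg X (by omega : n - (i : ℕ) = n + 1 - ((i : ℕ) + 1))) x⟩

/-- The unit of the cone construction, `x ↦ (x, 0)`. -/
def hatEta (n : ℕ) (x : X n) : hatC X n := some ⟨⟨0, n.succ_pos⟩, x⟩

variable {X} in
/-- The map `Ĉf` induced on unreduced cones by a degreewise map `f`. -/
def hatMap {Y : ℕ → Type} (f : ∀ m, X m → Y m) (n : ℕ) : hatC X n → hatC Y n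
  | none => none
  | some ⟨i, x⟩ => some ⟨i, f _ x⟩

/-- The multiplication `ĈĈX → ĈX`, `((x,i),j) ↦ (x, i+j)`. -/
def hatMu (n : ℕ) : hatC (fun m => hatC X m) n → hatC X n
  | none => none
  | some ⟨j, z⟩ =>
      match z with
      | none => none
      | some ⟨i, x⟩ =>
          some ⟨⟨(i : ℕ) + (j : ℕ), by have := i.isLt; have := j.isLt; omega⟩,
            cast (congrArg X
              (by omega : n - (j : ℕ) - (i : ℕ) = n - ((i : ℕ) + (j : ℕ)))) x⟩

variable {X} in
/-- The simplices of the unreduced cone lying in the cone on a degreewise subset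
(typically, the cone on the base point). -/
def isBaseP (P : ∀ m, X m → Prop) (n : ℕ) : hatC X n → Prop
  | none => True
  | some ⟨_, x⟩ => P _ x

/-- The base point of a based simplicial set `(X, pt)` spans a cone `Ĉ{*} ⊆ ĈX`; the
reduced cone `CX` is the quotient of `ĈX` collapsing `Ĉ{*}`.  Two simplices of `ĈX`
represent the same simplex of `CX` iff they are equal or both lie in `Ĉ{*}`. -/
def coneRel (pt : ∀ m, X m) (n : ℕ) (a b : hatC X n) : Prop :=
  a = b ∨ (isBaseP (fun m x => x = pt m) n a ∧ isBaseP (fun m x => x = pt m) n b)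

end Cone

section HatMk

variable {X Y : ℕ → Type}

/-- The simplex `(x, i)` of the unreduced cone, with `x` of dimension `m` and `i + m = n`. -/
def hatMk (i m n : ℕ) (h : i + m = n) (x : X m) : hatC X n :=
  some ⟨⟨i, by omega⟩, cast (congrArg X (by simp only; omega)) x⟩

theorem hatC_cases {n : ℕ} (w : hatC X n) :
    w = none ∨ ∃ i m h x, w = hatMk i m n h x := by
  rcases w with _ | ⟨i, x⟩
  · exact Or.inl rfl
  · exact Or.inr ⟨i, n - i, by have := i.isLt; omega, x, rfl⟩

theorem hatC_some_congr {n : ℕ} {i i' : Fin (n + 1)} {x : X (n - (i : ℕ))}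
    {x' : X (n - (i' : ℕ))} (hi : (i : ℕ) = i') (hx : HEq x x') :
    (some ⟨i, x⟩ : hatC X n) = some ⟨i', x'⟩ := by
  obtain rfl := Fin.ext hi
  obtain rfl := eq_of_heq hx
  rfl

theorem hatMk_injective {i m n : ℕ} (h : i + m = n) :
    Function.Injective (hatMk (X := X) i m n h) := by
  obtain rfl : m = n - i := by omega
  intro x y hxy
  have := Option.some.inj hxy
  simpa using this

theorem heq_apply {F : ℕ → ℕ} (f : ∀ n, X n → Y (F n)) {m k : ℕ} (hmk : m = k) {x : X m}
    {y : X k} (hxy : HEq x y) : HEq (f m x) (f k y) := by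
  subst hmk
  obtain rfl := eq_of_heq hxy
  rfl

theorem heq_face (dX : ℕ → ∀ n, X (n + 1) → X n) (j : ℕ) {m k : ℕ} (hmk : m = k)
    {x : X (m + 1)} {y : X (k + 1)} (hxy : HEq x y) : HEq (dX j m x) (dX j k y) := by
  subst hmk
  obtain rfl := eq_of_heq hxy
  rfl

theorem hatEta_eq (n : ℕ) (x : X n) : hatEta X n x = hatMk 0 n n (by omega) x := rfl

theorem hatMap_none (f : ∀ m, X m → Y m) (n : ℕ) : hatMap f n none = none := rfl

theorem hatMap_hatMk (f : ∀ m, X m → Y m) {i m n : ℕ} (h : i + m = n) (x : X m) :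
    hatMap f n (hatMk i m n h x) = hatMk i m n h (f m x) := by
  obtain rfl : m = n - i := by omega
  rfl

theorem hatMap_hatMap {Z : ℕ → Type} (g : ∀ m, Y m → Z m) (f : ∀ m, X m → Y m) (n : ℕ)
    (w : hatC X n) : hatMap g n (hatMap f n w) = hatMap (fun m x => g m (f m x)) n w := by
  rcases w with _ | ⟨i, x⟩ <;> rfl

theorem hatMap_injective {f : ∀ m, X m → Y m} (hf : ∀ m, Function.Injective (f m)) (n : ℕ) :
    Function.Injective (hatMap f n) := by
  rintro (_ | ⟨i, x⟩) (_ | ⟨j, y⟩) h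
  · rfl
  · cases h
  · cases h
  · have h' := Option.some.inj h
    obtain rfl : i = j := congrArg Sigma.fst h'
    have := hf _ (eq_of_heq (Sigma.mk.inj h').2)
    rw [this]

section Operators

variable (dX : ℕ → ∀ n, X (n + 1) → X n) (sX : ℕ → ∀ n, X n → X (n + 1))

theorem hatD_none (j n : ℕ) : hatD X dX j n none = none := rfl

theorem hatS_none (j n : ℕ) : hatS X sX j n none = none := rfl

theorem hatD_hatMk_of_le {j i m n : ℕ} (h : i + (m + 1) = n + 1) (hj : j ≤ m + 1)
    (x : X (m + 1)) :
    hatD X dX j n (hatMk i (m + 1) (n + 1) h x) = hatMk i m n (by omega) (dX j m x) := by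
  simp only [hatMk, hatD]
  refine (dif_pos (by omega)).trans ((dif_pos (by omega)).trans ?_)
  refine hatC_some_congr rfl ?_
  refine HEq.trans (heq_face dX j (by omega) ?_) (cast_heq _ _).symm
  exact (cast_heq _ _).trans (cast_heq _ _)

theorem hatD_hatMk_zero {i n : ℕ} (h : i + 0 = n + 1) (x : X 0) :
    hatD X dX 0 n (hatMk i 0 (n + 1) h x) = none := by
  simp only [hatMk, hatD]
  exact (dif_pos (by omega)).trans (dif_neg (by omega))

theorem hatD_hatMk_of_lt {j i m n : ℕ} (h : i + 1 + m = n + 1) (hj : m < j) (x : X m) :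
    hatD X dX j n (hatMk (i + 1) m (n + 1) h x) = hatMk i m n (by omega) x := by
  simp only [hatMk, hatD]
  refine (dif_neg (by omega)).trans ((dif_pos (by omega)).trans ?_)
  refine hatC_some_congr rfl ?_
  exact ((cast_heq _ _).trans (cast_heq _ _)).trans (cast_heq _ _).symm

theorem hatS_hatMk_of_le {j i m n : ℕ} (h : i + m = n) (hj : j ≤ m) (x : X m) :
    hatS X sX j n (hatMk i m n h x) = hatMk i (m + 1) (n + 1) (by omega) (sX j m x) := by
  simp only [hatMk, hatS]
  refine (dif_pos (by omega)).trans ?_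
  refine hatC_some_congr rfl ?_
  refine ((cast_heq _ _).trans ?_).trans (cast_heq _ _).symm
  exact heq_apply (F := fun n => n + 1) (sX j) (by omega) (cast_heq _ _)

theorem hatS_hatMk_of_lt {j i m n : ℕ} (h : i + m = n) (hj : m < j) (x : X m) :
    hatS X sX j n (hatMk i m n h x) = hatMk (i + 1) m (n + 1) (by omega) x := by
  simp only [hatMk, hatS]
  refine (dif_neg (by omega)).trans ?_
  refine hatC_some_congr rfl ?_
  exact ((cast_heq _ _).trans (cast_heq _ _)).trans (cast_heq _ _).symm

end Operators

theorem hatMu_none (n : ℕ) : hatMu X n none = none := rfl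

theorem hatMu_hatMk_none {i m n : ℕ} (h : i + m = n) :
    hatMu X n (hatMk (X := fun m => hatC X m) i m n h none) = none := by
  obtain rfl : m = n - i := by omega
  rfl

theorem hatMu_hatMk {j m n i k : ℕ} (h : j + m = n) (h' : i + k = m) (x : X k) :
    hatMu X n (hatMk (X := fun m => hatC X m) j m n h (hatMk i k m h' x)) =
      hatMk (i + j) k n (by omega) x := by
  obtain rfl : m = n - j := by omega
  refine hatC_some_congr rfl ?_
  exact ((cast_heq _ _).trans (cast_heq _ _)).trans (cast_heq _ _).symm

theorem hatMu_hatEta (n : ℕ) (w : hatC X n) : hatMu X n (hatEta (fun m => hatC X m) n w) = w := by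
  rcases hatC_cases w with rfl | ⟨i, m, h, x, rfl⟩
  · rfl
  · rw [hatEta_eq, hatMu_hatMk]
    rfl

theorem hatMu_hatMap_hatEta (n : ℕ) (w : hatC X n) :
    hatMu X n (hatMap (fun m => hatEta X m) n w) = w := by
  rcases hatC_cases w with rfl | ⟨i, m, h, x, rfl⟩
  · rfl
  · rw [hatMap_hatMk, hatEta_eq, hatMu_hatMk]
    simp only [Nat.zero_add]

theorem hatMu_natural (f : ∀ m, X m → Y m) (n : ℕ) (z : hatC (fun m => hatC X m) n) :
    hatMu Y n (hatMap (hatMap f) n z) = hatMap f n (hatMu X n z) := by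
  rcases z with _ | ⟨j, _ | ⟨i, x⟩⟩
  · rfl
  · rfl
  · rw [show (some ⟨j, some ⟨i, x⟩⟩ : hatC (fun m => hatC X m) n) =
      hatMk (X := fun m => hatC X m) j (n - j) n (by omega)
        (hatMk i (n - j - i) (n - j) (by omega) x) from rfl]
    simp only [hatMap_hatMk, hatMu_hatMk]

theorem hatMu_assoc (n : ℕ) (z : hatC (fun m => hatC (fun k => hatC X k) m) n) :
    hatMu X n (hatMap (fun m => hatMu X m) n z) =
      hatMu X n (hatMu (fun m => hatC X m) n z) := by
  rcases hatC_cases z with rfl | ⟨i, m, h, w, rfl⟩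
  · rfl
  rw [hatMap_hatMk]
  rcases hatC_cases w with rfl | ⟨i', m', h', y, rfl⟩
  · rw [hatMu_none, hatMu_hatMk_none, hatMu_hatMk_none, hatMu_none]
  rw [hatMu_hatMk]
  rcases hatC_cases y with rfl | ⟨i'', m'', h'', x, rfl⟩
  · simp only [hatMu_hatMk_none]
    rfl
  · simp only [hatMu_hatMk, Nat.add_assoc]

section Naturality

variable {dX : ℕ → ∀ n, X (n + 1) → X n} {sX : ℕ → ∀ n, X n → X (n + 1)}
  {dY : ℕ → ∀ n, Y (n + 1) → Y n} {sY : ℕ → ∀ n, Y n → Y (n + 1)}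

theorem hatMap_hatD {f : ∀ m, X m → Y m}
    (hf : ∀ j n, j ≤ n + 1 → ∀ x, f n (dX j n x) = dY j n (f (n + 1) x))
    {j n : ℕ} (hj : j ≤ n + 1) (w : hatC X (n + 1)) :
    hatMap f n (hatD X dX j n w) = hatD Y dY j n (hatMap f (n + 1) w) := by
  rcases hatC_cases w with rfl | ⟨i, m, h, x, rfl⟩
  · rfl
  rw [hatMap_hatMk]
  rcases le_or_gt j m with hjm | hjm
  · rcases m with _ | m
    · obtain rfl : j = 0 := by omega
      simp only [hatD_hatMk_zero, hatMap_none]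
      rfl
    · rw [hatD_hatMk_of_le _ _ hjm, hatD_hatMk_of_le _ _ hjm, hatMap_hatMk, hf _ _ hjm]
  · obtain ⟨i, rfl⟩ : ∃ i', i = i' + 1 := ⟨i - 1, by omega⟩
    rw [hatD_hatMk_of_lt _ _ hjm, hatD_hatMk_of_lt _ _ hjm, hatMap_hatMk]

theorem hatMap_hatS {f : ∀ m, X m → Y m}
    (hf : ∀ j n, j ≤ n → ∀ x, f (n + 1) (sX j n x) = sY j n (f n x))
    {j n : ℕ} (w : hatC X n) :
    hatMap f (n + 1) (hatS X sX j n w) = hatS Y sY j n (hatMap f n w) := by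
  rcases hatC_cases w with rfl | ⟨i, m, h, x, rfl⟩
  · rfl
  rw [hatMap_hatMk]
  rcases le_or_gt j m with hjm | hjm
  · rw [hatS_hatMk_of_le _ _ hjm, hatS_hatMk_of_le _ _ hjm, hatMap_hatMk, hf _ _ hjm]
  · rw [hatS_hatMk_of_lt _ _ hjm, hatS_hatMk_of_lt _ _ hjm, hatMap_hatMk]

end Naturality

theorem hatMu_hatD (dX : ℕ → ∀ n, X (n + 1) → X n) {j n : ℕ} (hj : j ≤ n + 1)
    (z : hatC (fun m => hatC X m) (n + 1)) :
    hatMu X n (hatD (fun m => hatC X m) (hatD X dX) j n z) =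
      hatD X dX j n (hatMu X (n + 1) z) := by
  rcases hatC_cases z with rfl | ⟨i, m, h, w, rfl⟩
  · rfl
  rcases le_or_gt j m with hjm | hjm
  · rcases m with _ | m
    · obtain rfl : j = 0 := by omega
      rw [hatD_hatMk_zero]
      rcases hatC_cases w with rfl | ⟨a, k, h', x, rfl⟩
      · rw [hatMu_hatMk_none, hatD_none, hatMu_none]
      · obtain rfl : k = 0 := by omega
        rw [hatMu_hatMk, hatD_hatMk_zero, hatMu_none]
    · rw [hatD_hatMk_of_le _ _ hjm]
      rcases hatC_cases w with rfl | ⟨a, k, h', x, rfl⟩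
      · simp only [hatMu_hatMk_none, hatD_none]
        rfl
      rw [hatMu_hatMk]
      rcases le_or_gt j k with hjk | hjk
      · rcases k with _ | k
        · obtain rfl : j = 0 := by omega
          simp only [hatD_hatMk_zero, hatMu_hatMk_none]
          rfl
        · rw [hatD_hatMk_of_le _ _ hjk, hatD_hatMk_of_le _ _ hjk, hatMu_hatMk]
      · obtain ⟨a, rfl⟩ : ∃ a', a = a' + 1 := ⟨a - 1, by omega⟩
        rw [hatD_hatMk_of_lt _ _ hjk, hatMu_hatMk]
        simp only [Nat.add_right_comm a 1 i]
        rw [hatD_hatMk_of_lt _ _ hjk]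
  · obtain ⟨i, rfl⟩ : ∃ i', i = i' + 1 := ⟨i - 1, by omega⟩
    rw [hatD_hatMk_of_lt _ _ hjm]
    rcases hatC_cases w with rfl | ⟨a, k, h', x, rfl⟩
    · simp only [hatMu_hatMk_none, hatD_none]
      rfl
    rw [hatMu_hatMk, hatMu_hatMk]
    simp only [← Nat.add_assoc a i 1]
    rw [hatD_hatMk_of_lt _ _ (by omega)]

theorem hatMu_hatS (sX : ℕ → ∀ n, X n → X (n + 1)) {j n : ℕ}
    (z : hatC (fun m => hatC X m) n) :
    hatMu X (n + 1) (hatS (fun m => hatC X m) (hatS X sX) j n z) =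
      hatS X sX j n (hatMu X n z) := by
  rcases hatC_cases z with rfl | ⟨i, m, h, w, rfl⟩
  · rfl
  rcases le_or_gt j m with hjm | hjm
  · rw [hatS_hatMk_of_le _ _ hjm]
    rcases hatC_cases w with rfl | ⟨a, k, h', x, rfl⟩
    · simp only [hatMu_hatMk_none, hatS_none]
      rfl
    rw [hatMu_hatMk]
    rcases le_or_gt j k with hjk | hjk
    · rw [hatS_hatMk_of_le _ _ hjk, hatS_hatMk_of_le _ _ hjk, hatMu_hatMk]
    · rw [hatS_hatMk_of_lt _ _ hjk, hatS_hatMk_of_lt _ _ hjk, hatMu_hatMk]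
      simp only [Nat.add_right_comm a 1 i]
  · rw [hatS_hatMk_of_lt _ _ hjm]
    rcases hatC_cases w with rfl | ⟨a, k, h', x, rfl⟩
    · simp only [hatMu_hatMk_none, hatS_none]
      rfl
    rw [hatMu_hatMk, hatMu_hatMk, hatS_hatMk_of_lt _ _ (by omega)]
    simp only [Nat.add_assoc]

end HatMk

section Identities

variable (E : BSSet)

theorem hatD_hatD {i j n : ℕ} (hij : i < j) (hj : j ≤ n + 2) (w : hatC E.X (n + 2)) :
    hatD E.X E.d i n (hatD E.X E.d j (n + 1) w) =
      hatD E.X E.d (j - 1) n (hatD E.X E.d i (n + 1) w) := by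
  rcases hatC_cases w with rfl | ⟨a, k, h, x, rfl⟩
  · rfl
  rcases le_or_gt j k with hjk | hjk
  · obtain ⟨k, rfl⟩ : ∃ k', k = k' + 1 := ⟨k - 1, by omega⟩
    rw [hatD_hatMk_of_le _ _ hjk, hatD_hatMk_of_le _ _ (by omega)]
    rcases k with _ | k
    · obtain rfl : i = 0 := by omega
      obtain rfl : j = 1 := by omega
      rw [hatD_hatMk_zero, hatD_hatMk_zero]
    · rw [hatD_hatMk_of_le _ _ (by omega), hatD_hatMk_of_le _ _ (by omega),
        E.dd _ _ _ hij (by omega)]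
  · obtain ⟨a, rfl⟩ : ∃ a', a = a' + 1 := ⟨a - 1, by omega⟩
    rw [hatD_hatMk_of_lt _ _ hjk]
    rcases le_or_gt i k with hik | hik
    · rcases k with _ | k
      · obtain rfl : i = 0 := by omega
        rw [hatD_hatMk_zero, hatD_hatMk_zero, hatD_none]
      · rw [hatD_hatMk_of_le _ _ hik, hatD_hatMk_of_le _ _ hik,
          hatD_hatMk_of_lt _ _ (by omega)]
    · obtain ⟨a, rfl⟩ : ∃ a', a = a' + 1 := ⟨a - 1, by omega⟩
      rw [hatD_hatMk_of_lt _ _ hik, hatD_hatMk_of_lt _ _ hik, hatD_hatMk_of_lt _ _ (by omega)]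

theorem hatS_hatS {i j n : ℕ} (hij : i ≤ j) (w : hatC E.X n) :
    hatS E.X E.s i (n + 1) (hatS E.X E.s j n w) =
      hatS E.X E.s (j + 1) (n + 1) (hatS E.X E.s i n w) := by
  rcases hatC_cases w with rfl | ⟨a, k, h, x, rfl⟩
  · rfl
  rcases le_or_gt j k with hjk | hjk
  · rw [hatS_hatMk_of_le _ _ hjk, hatS_hatMk_of_le _ _ (by omega),
      hatS_hatMk_of_le _ _ (by omega), hatS_hatMk_of_le _ _ (by omega), E.ss _ _ _ hij hjk]
  · rw [hatS_hatMk_of_lt _ _ hjk]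
    rcases le_or_gt i k with hik | hik
    · rw [hatS_hatMk_of_le _ _ hik, hatS_hatMk_of_le _ _ hik, hatS_hatMk_of_lt _ _ (by omega)]
    · rw [hatS_hatMk_of_lt _ _ hik, hatS_hatMk_of_lt _ _ hik, hatS_hatMk_of_lt _ _ (by omega)]

theorem hatD_hatS_of_lt {i j n : ℕ} (hij : i < j) (hj : j ≤ n + 1) (w : hatC E.X (n + 1)) :
    hatD E.X E.d i (n + 1) (hatS E.X E.s j (n + 1) w) =
      hatS E.X E.s (j - 1) n (hatD E.X E.d i n w) := by
  rcases hatC_cases w with rfl | ⟨a, k, h, x, rfl⟩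
  · rfl
  rcases le_or_gt j k with hjk | hjk
  · obtain ⟨k, rfl⟩ : ∃ k', k = k' + 1 := ⟨k - 1, by omega⟩
    rw [hatS_hatMk_of_le _ _ hjk, hatD_hatMk_of_le _ _ (by omega),
      hatD_hatMk_of_le _ _ (by omega), hatS_hatMk_of_le _ _ (by omega), E.ds_lt _ _ _ hij hjk]
  · rw [hatS_hatMk_of_lt _ _ hjk]
    rcases le_or_gt i k with hik | hik
    · rcases k with _ | k
      · obtain rfl : i = 0 := by omega
        rw [hatD_hatMk_zero, hatD_hatMk_zero, hatS_none]
      · rw [hatD_hatMk_of_le _ _ hik, hatD_hatMk_of_le _ _ hik, hatS_hatMk_of_lt _ _ (by omega)]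
    · obtain ⟨a, rfl⟩ : ∃ a', a = a' + 1 := ⟨a - 1, by omega⟩
      rw [hatD_hatMk_of_lt _ _ hik, hatD_hatMk_of_lt _ _ hik, hatS_hatMk_of_lt _ _ (by omega)]

theorem hatD_hatS_self {j n : ℕ} (w : hatC E.X n) :
    hatD E.X E.d j n (hatS E.X E.s j n w) = w := by
  rcases hatC_cases w with rfl | ⟨a, k, h, x, rfl⟩
  · rfl
  rcases le_or_gt j k with hjk | hjk
  · rw [hatS_hatMk_of_le _ _ hjk, hatD_hatMk_of_le _ _ (by omega), E.ds_eq _ _ hjk]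
  · rw [hatS_hatMk_of_lt _ _ hjk, hatD_hatMk_of_lt _ _ hjk]

theorem hatD_succ_hatS {j n : ℕ} (w : hatC E.X n) :
    hatD E.X E.d (j + 1) n (hatS E.X E.s j n w) = w := by
  rcases hatC_cases w with rfl | ⟨a, k, h, x, rfl⟩
  · rfl
  rcases le_or_gt j k with hjk | hjk
  · rw [hatS_hatMk_of_le _ _ hjk, hatD_hatMk_of_le _ _ (by omega), E.ds_succ _ _ hjk]
  · rw [hatS_hatMk_of_lt _ _ hjk, hatD_hatMk_of_lt _ _ (by omega)]

theorem hatD_hatS_of_gt {i j n : ℕ} (hij : j + 1 < i) (hi : i ≤ n + 2) (w : hatC E.X (n + 1)) :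
    hatD E.X E.d i (n + 1) (hatS E.X E.s j (n + 1) w) =
      hatS E.X E.s j n (hatD E.X E.d (i - 1) n w) := by
  rcases hatC_cases w with rfl | ⟨a, k, h, x, rfl⟩
  · rfl
  rcases le_or_gt j k with hjk | hjk
  · rw [hatS_hatMk_of_le _ _ hjk]
    rcases le_or_gt i (k + 1) with hik | hik
    · obtain ⟨k, rfl⟩ : ∃ k', k = k' + 1 := ⟨k - 1, by omega⟩
      rw [hatD_hatMk_of_le _ _ hik, hatD_hatMk_of_le _ _ (by omega),
        hatS_hatMk_of_le _ _ (by omega), E.ds_gt _ _ _ hij (by omega)]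
    · obtain ⟨a, rfl⟩ : ∃ a', a = a' + 1 := ⟨a - 1, by omega⟩
      rw [hatD_hatMk_of_lt _ _ hik, hatD_hatMk_of_lt _ _ (by omega), hatS_hatMk_of_le _ _ hjk]
  · obtain ⟨a, rfl⟩ : ∃ a', a = a' + 1 := ⟨a - 1, by omega⟩
    rw [hatS_hatMk_of_lt _ _ hjk, hatD_hatMk_of_lt _ _ (by omega),
      hatD_hatMk_of_lt _ _ (by omega), hatS_hatMk_of_lt _ _ hjk]

end Identities

/-- A based simplicial subset `α : D → E` together with a conical contraction `ψ : CD → D`. -/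
structure ContractedSubset (D E : BSSet) where
  alpha : ∀ n, D.X n → E.X n
  alpha_injective : ∀ n, Function.Injective (alpha n)
  alpha_pt : ∀ n, alpha n (D.pt n) = E.pt n
  alpha_d : ∀ j n, j ≤ n + 1 → ∀ x, alpha n (D.d j n x) = E.d j n (alpha (n + 1) x)
  alpha_s : ∀ j n, j ≤ n → ∀ x, alpha (n + 1) (D.s j n x) = E.s j n (alpha n x)
  psi : ∀ n, hatC D.X n → D.X n
  psi_none : ∀ n, psi n none = D.pt n
  psi_base : ∀ n (i : Fin (n + 1)), psi n (some ⟨i, D.pt _⟩) = D.pt n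
  psi_unit : ∀ n x, psi n (hatEta D.X n x) = x
  psi_d : ∀ j n, j ≤ n + 1 → ∀ z, psi n (hatD D.X D.d j n z) = D.d j n (psi (n + 1) z)
  psi_s : ∀ j n, j ≤ n → ∀ z, psi (n + 1) (hatS D.X D.s j n z) = D.s j n (psi n z)
  psi_conical : ∀ n (z : hatC (fun m => hatC D.X m) n),
    psi n (hatMap (fun m => psi m) n z) = psi n (hatMu D.X n z)

namespace ContractedSubset

variable {D E : BSSet} (S : ContractedSubset D E)

/-- The gluing relation presenting the pushout of `ψ` along `Cα`. -/
def Glue (n : ℕ) (a b : D.X n ⊕ hatC E.X n) : Prop :=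
  ∃ z, a = Sum.inr (hatMap S.alpha n z) ∧ b = Sum.inl (S.psi n z)

/-- The simplices of the pushout of `ψ` along `Cα`. -/
def Simplex (n : ℕ) : Type := Quot (S.Glue n)

/-- The structure map of the pushout on `D`. -/
def ofSubset (n : ℕ) (x : D.X n) : S.Simplex n := Quot.mk _ (Sum.inl x)

/-- The structure map of the pushout on the cone of `E`. -/
def ofCone (n : ℕ) (w : hatC E.X n) : S.Simplex n := Quot.mk _ (Sum.inr w)

theorem ofCone_hatMap (n : ℕ) (z : hatC D.X n) :
    S.ofCone n (hatMap S.alpha n z) = S.ofSubset n (S.psi n z) :=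
  Quot.sound ⟨z, rfl, rfl⟩

theorem simplex_cases {n : ℕ} (q : S.Simplex n) :
    (∃ x, q = S.ofSubset n x) ∨ ∃ w, q = S.ofCone n w := by
  rcases Quot.exists_rep q with ⟨x | w, rfl⟩
  · exact Or.inl ⟨x, rfl⟩
  · exact Or.inr ⟨w, rfl⟩

/-- Maps out of the pushout. -/
def desc {n : ℕ} {Z : Type} (f : D.X n → Z) (g : hatC E.X n → Z)
    (h : ∀ z, g (hatMap S.alpha n z) = f (S.psi n z)) : S.Simplex n → Z :=
  Quot.lift (Sum.elim f g) (by
    rintro _ _ ⟨z, rfl, rfl⟩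
    exact h z)

theorem ofCone_none (n : ℕ) : S.ofCone n none = S.ofSubset n (D.pt n) :=
  (S.ofCone_hatMap n none).trans (congrArg (S.ofSubset n) (S.psi_none n))

theorem ofCone_base {n : ℕ} {w : hatC E.X n} (hw : isBaseP (fun m x => x = E.pt m) n w) :
    S.ofCone n w = S.ofSubset n (D.pt n) := by
  rcases w with _ | ⟨i, x⟩
  · exact S.ofCone_none n
  · obtain rfl : x = E.pt _ := hw
    rw [← S.alpha_pt]
    exact (S.ofCone_hatMap n (some ⟨i, D.pt _⟩)).trans
      (congrArg (S.ofSubset n) (S.psi_base n i))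

theorem ofCone_eq_of_coneRel {n : ℕ} {a b : hatC E.X n} (h : coneRel E.X E.pt n a b) :
    S.ofCone n a = S.ofCone n b := by
  rcases h with rfl | ⟨ha, hb⟩
  · rfl
  · rw [S.ofCone_base ha, S.ofCone_base hb]

/-- The face operators of the pushout, trivial out of range. -/
def face (j n : ℕ) : S.Simplex (n + 1) → S.Simplex n :=
  if hj : j ≤ n + 1 then
    S.desc (fun x => S.ofSubset n (D.d j n x)) (fun w => S.ofCone n (hatD E.X E.d j n w))
      (fun z => by
        rw [← hatMap_hatD S.alpha_d hj, S.ofCone_hatMap, S.psi_d j n hj])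
  else fun _ => S.ofSubset n (D.pt n)

/-- The degeneracy operators of the pushout, trivial out of range. -/
def degen (j n : ℕ) : S.Simplex n → S.Simplex (n + 1) :=
  if hj : j ≤ n then
    S.desc (fun x => S.ofSubset (n + 1) (D.s j n x))
      (fun w => S.ofCone (n + 1) (hatS E.X E.s j n w))
      (fun z => by
        rw [← hatMap_hatS S.alpha_s, S.ofCone_hatMap, S.psi_s j n hj])
  else fun _ => S.ofSubset (n + 1) (D.pt (n + 1))

theorem face_ofSubset {j n : ℕ} (hj : j ≤ n + 1) (x : D.X (n + 1)) :
    S.face j n (S.ofSubset (n + 1) x) = S.ofSubset n (D.d j n x) := by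
  rw [face, dif_pos hj]
  rfl

theorem face_ofCone {j n : ℕ} (hj : j ≤ n + 1) (w : hatC E.X (n + 1)) :
    S.face j n (S.ofCone (n + 1) w) = S.ofCone n (hatD E.X E.d j n w) := by
  rw [face, dif_pos hj]
  rfl

theorem degen_ofSubset {j n : ℕ} (hj : j ≤ n) (x : D.X n) :
    S.degen j n (S.ofSubset n x) = S.ofSubset (n + 1) (D.s j n x) := by
  rw [degen, dif_pos hj]
  rfl

theorem degen_ofCone {j n : ℕ} (hj : j ≤ n) (w : hatC E.X n) :
    S.degen j n (S.ofCone n w) = S.ofCone (n + 1) (hatS E.X E.s j n w) := by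
  rw [degen, dif_pos hj]
  rfl

/-- The pushout of `ψ` along `Cα`, as a based simplicial set. -/
def enlargement : BSSet where
  X := S.Simplex
  pt n := S.ofSubset n (D.pt n)
  d := S.face
  s := S.degen
  d_pt j n := by
    by_cases hj : j ≤ n + 1
    · rw [S.face_ofSubset hj, D.d_pt]
    · rw [face, dif_neg hj]
  s_pt j n := by
    by_cases hj : j ≤ n
    · rw [S.degen_ofSubset hj, D.s_pt]
    · rw [degen, dif_neg hj]
  dd i j n hij hj q := by
    rcases S.simplex_cases q with ⟨x, rfl⟩ | ⟨w, rfl⟩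
    · rw [S.face_ofSubset (by omega), S.face_ofSubset (by omega), S.face_ofSubset (by omega),
        S.face_ofSubset (by omega), D.dd i j n hij hj]
    · rw [S.face_ofCone (by omega), S.face_ofCone (by omega), S.face_ofCone (by omega),
        S.face_ofCone (by omega), hatD_hatD E hij hj]
  ss i j n hij hj q := by
    rcases S.simplex_cases q with ⟨x, rfl⟩ | ⟨w, rfl⟩
    · rw [S.degen_ofSubset (by omega), S.degen_ofSubset (by omega),
        S.degen_ofSubset (by omega), S.degen_ofSubset (by omega), D.ss i j n hij hj]
    · rw [S.degen_ofCone (by omega), S.degen_ofCone (by omega), S.degen_ofCone (by omega),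
        S.degen_ofCone (by omega), hatS_hatS E hij]
  ds_lt i j n hij hj q := by
    rcases S.simplex_cases q with ⟨x, rfl⟩ | ⟨w, rfl⟩
    · rw [S.degen_ofSubset (by omega), S.face_ofSubset (by omega),
        S.face_ofSubset (by omega), S.degen_ofSubset (by omega), D.ds_lt i j n hij hj]
    · rw [S.degen_ofCone (by omega), S.face_ofCone (by omega), S.face_ofCone (by omega),
        S.degen_ofCone (by omega), hatD_hatS_of_lt E hij hj]
  ds_eq j n hj q := by
    rcases S.simplex_cases q with ⟨x, rfl⟩ | ⟨w, rfl⟩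
    · rw [S.degen_ofSubset hj, S.face_ofSubset (by omega), D.ds_eq j n hj]
    · rw [S.degen_ofCone hj, S.face_ofCone (by omega), hatD_hatS_self E]
  ds_succ j n hj q := by
    rcases S.simplex_cases q with ⟨x, rfl⟩ | ⟨w, rfl⟩
    · rw [S.degen_ofSubset hj, S.face_ofSubset (by omega), D.ds_succ j n hj]
    · rw [S.degen_ofCone hj, S.face_ofCone (by omega), hatD_succ_hatS E]
  ds_gt i j n hij hi q := by
    rcases S.simplex_cases q with ⟨x, rfl⟩ | ⟨w, rfl⟩
    · rw [S.degen_ofSubset (by omega), S.face_ofSubset (by omega),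
        S.face_ofSubset (by omega), S.degen_ofSubset (by omega), D.ds_gt i j n hij hi]
    · rw [S.degen_ofCone (by omega), S.face_ofCone (by omega), S.face_ofCone (by omega),
        S.degen_ofCone (by omega), hatD_hatS_of_gt E hij hi]

open Classical in
/-- A normal form for the simplices of the pushout: those coming from `D`, and those of the
cone of `E` outside the cone of `D`. -/
noncomputable def normalForm (n : ℕ) : S.Simplex n → D.X n ⊕ hatC E.X n :=
  S.desc Sum.inl
    (fun w => if h : ∃ z, hatMap S.alpha n z = w then Sum.inl (S.psi n h.choose)
      else Sum.inr w)
    (fun z => by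
      have h : ∃ z', hatMap S.alpha n z' = hatMap S.alpha n z := ⟨z, rfl⟩
      rw [dif_pos h, hatMap_injective S.alpha_injective n h.choose_spec])

theorem ofSubset_injective (n : ℕ) : Function.Injective (S.ofSubset n) := fun _ _ h =>
  Sum.inl_injective (congrArg (S.normalForm n) h)

theorem ofCone_hatEta_alpha (n : ℕ) (x : D.X n) :
    S.ofCone n (hatEta E.X n (S.alpha n x)) = S.ofSubset n x := by
  conv_rhs => rw [← S.psi_unit n x]
  rw [← S.ofCone_hatMap]
  rfl

theorem normalForm_ofCone {n : ℕ} {w : hatC E.X n} (h : ∀ z, hatMap S.alpha n z ≠ w) :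
    S.normalForm n (S.ofCone n w) = Sum.inr w :=
  dif_neg (by simpa using h)

theorem ofCone_hatEta_injective (n : ℕ) :
    Function.Injective (fun x => S.ofCone n (hatEta E.X n x)) := by
  have key : ∀ x : E.X n, (∀ y, S.alpha n y ≠ x) →
      S.normalForm n (S.ofCone n (hatEta E.X n x)) = Sum.inr (hatEta E.X n x) := by
    intro x hx
    refine S.normalForm_ofCone fun z hz => ?_
    rcases z with _ | ⟨i, y⟩
    · cases hz
    · have h := Option.some.inj hz
      obtain rfl : i = ⟨0, n.succ_pos⟩ := congrArg Sigma.fst h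
      exact hx y (eq_of_heq (Sigma.mk.inj h).2)
  intro x y hxy
  have hxy : S.ofCone n (hatEta E.X n x) = S.ofCone n (hatEta E.X n y) := hxy
  by_cases hx : ∃ a, S.alpha n a = x <;> by_cases hy : ∃ b, S.alpha n b = y
  · obtain ⟨a, rfl⟩ := hx
    obtain ⟨b, rfl⟩ := hy
    rw [S.ofCone_hatEta_alpha, S.ofCone_hatEta_alpha] at hxy
    rw [S.ofSubset_injective n hxy]
  · obtain ⟨a, rfl⟩ := hx
    have h := congrArg (S.normalForm n) hxy
    rw [S.ofCone_hatEta_alpha, key y (by simpa using hy)] at h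
    cases h
  · obtain ⟨b, rfl⟩ := hy
    have h := congrArg (S.normalForm n) hxy
    rw [S.ofCone_hatEta_alpha, key x (by simpa using hx)] at h
    cases h
  · have h := congrArg (S.normalForm n) hxy
    rw [key x (by simpa using hx), key y (by simpa using hy)] at h
    exact hatMk_injective (Nat.zero_add n) (Sum.inr_injective h)

/-- The induced conical contraction of the pushout. -/
def contraction (n : ℕ) : hatC S.Simplex n → S.Simplex n
  | none => S.ofSubset n (D.pt n)
  | some ⟨i, q⟩ =>
      S.desc (fun x => S.ofSubset n (S.psi n (some ⟨i, x⟩)))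
        (fun w => S.ofCone n (hatMu E.X n (some ⟨i, w⟩)))
        (fun z => by
          have h1 := hatMu_natural S.alpha n (some ⟨i, z⟩)
          have h2 := S.psi_conical n (some ⟨i, z⟩)
          exact (congrArg (S.ofCone n) h1).trans ((S.ofCone_hatMap n _).trans
            (congrArg (S.ofSubset n) h2.symm))) q

theorem contraction_none (n : ℕ) : S.contraction n none = S.ofSubset n (D.pt n) := rfl

theorem contraction_hatMap_ofSubset (n : ℕ) (z : hatC D.X n) :
    S.contraction n (hatMap S.ofSubset n z) = S.ofSubset n (S.psi n z) := by
  rcases z with _ | ⟨i, x⟩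
  · exact congrArg (S.ofSubset n) (S.psi_none n).symm
  · rfl

theorem contraction_hatMap_ofCone (n : ℕ) (z : hatC (fun m => hatC E.X m) n) :
    S.contraction n (hatMap S.ofCone n z) = S.ofCone n (hatMu E.X n z) := by
  rcases z with _ | ⟨i, w⟩
  · exact (S.ofCone_none n).symm
  · rfl

theorem hatC_simplex_cases {n : ℕ} (z : hatC S.Simplex n) :
    (∃ z', z = hatMap S.ofSubset n z') ∨ ∃ z', z = hatMap S.ofCone n z' := by
  rcases z with _ | ⟨i, q⟩
  · exact Or.inl ⟨none, rfl⟩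
  · rcases S.simplex_cases q with ⟨x, rfl⟩ | ⟨w, rfl⟩
    · exact Or.inl ⟨some ⟨i, x⟩, rfl⟩
    · exact Or.inr ⟨some ⟨i, w⟩, rfl⟩

theorem hatC_hatC_simplex_cases {n : ℕ} (z : hatC (fun m => hatC S.Simplex m) n) :
    (∃ z', z = hatMap (hatMap S.ofSubset) n z') ∨
      ∃ z', z = hatMap (hatMap S.ofCone) n z' := by
  rcases z with _ | ⟨i, q⟩
  · exact Or.inl ⟨none, rfl⟩
  · rcases S.hatC_simplex_cases q with ⟨x, rfl⟩ | ⟨w, rfl⟩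
    · exact Or.inl ⟨some ⟨i, x⟩, rfl⟩
    · exact Or.inr ⟨some ⟨i, w⟩, rfl⟩

theorem contraction_hatEta (n : ℕ) (q : S.Simplex n) :
    S.contraction n (hatEta S.Simplex n q) = q := by
  rcases S.simplex_cases q with ⟨x, rfl⟩ | ⟨w, rfl⟩
  · exact (S.contraction_hatMap_ofSubset n (hatEta D.X n x)).trans
      (congrArg (S.ofSubset n) (S.psi_unit n x))
  · exact (S.contraction_hatMap_ofCone n (hatEta (fun m => hatC E.X m) n w)).trans
      (congrArg (S.ofCone n) (hatMu_hatEta n w))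

theorem contraction_hatD {j n : ℕ} (hj : j ≤ n + 1) (z : hatC S.Simplex (n + 1)) :
    S.contraction n (hatD S.Simplex S.face j n z) = S.face j n (S.contraction (n + 1) z) := by
  rcases S.hatC_simplex_cases z with ⟨z, rfl⟩ | ⟨z, rfl⟩
  · rw [← hatMap_hatD (fun j n hj x => (S.face_ofSubset hj x).symm) hj,
      S.contraction_hatMap_ofSubset, S.contraction_hatMap_ofSubset, S.psi_d j n hj,
      S.face_ofSubset hj]
  · rw [← hatMap_hatD (fun j n hj x => (S.face_ofCone hj x).symm) hj,
      S.contraction_hatMap_ofCone, S.contraction_hatMap_ofCone, hatMu_hatD _ hj,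
      S.face_ofCone hj]

theorem contraction_hatS {j n : ℕ} (hj : j ≤ n) (z : hatC S.Simplex n) :
    S.contraction (n + 1) (hatS S.Simplex S.degen j n z) =
      S.degen j n (S.contraction n z) := by
  rcases S.hatC_simplex_cases z with ⟨z, rfl⟩ | ⟨z, rfl⟩
  · rw [← hatMap_hatS (fun j n hj x => (S.degen_ofSubset hj x).symm),
      S.contraction_hatMap_ofSubset, S.contraction_hatMap_ofSubset, S.psi_s j n hj,
      S.degen_ofSubset hj]
  · rw [← hatMap_hatS (fun j n hj x => (S.degen_ofCone hj x).symm),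
      S.contraction_hatMap_ofCone, S.contraction_hatMap_ofCone, hatMu_hatS,
      S.degen_ofCone hj]

theorem contraction_conical (n : ℕ) (z : hatC (fun m => hatC S.Simplex m) n) :
    S.contraction n (hatMap (fun m => S.contraction m) n z) =
      S.contraction n (hatMu S.Simplex n z) := by
  rcases S.hatC_hatC_simplex_cases z with ⟨z, rfl⟩ | ⟨z, rfl⟩
  · rw [hatMu_natural, S.contraction_hatMap_ofSubset, ← S.psi_conical,
      ← S.contraction_hatMap_ofSubset, hatMap_hatMap, hatMap_hatMap]
    simp only [S.contraction_hatMap_ofSubset]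
  · rw [hatMu_natural, S.contraction_hatMap_ofCone, ← hatMu_assoc,
      ← S.contraction_hatMap_ofCone, hatMap_hatMap, hatMap_hatMap]
    simp only [S.contraction_hatMap_ofCone]

theorem contraction_hatMap_ofCone_hatEta (n : ℕ) (w : hatC E.X n) :
    S.contraction n (hatMap (fun m x => S.ofCone m (hatEta E.X m x)) n w) = S.ofCone n w := by
  rw [← hatMap_hatMap (fun m => S.ofCone m) (fun m => hatEta E.X m)]
  exact (S.contraction_hatMap_ofCone n _).trans
    (congrArg (S.ofCone n) (hatMu_hatMap_hatEta n w))

end ContractedSubset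

/-- enlargement of a conical contraction in based simplicial sets.
Given a based simplicial subset `D` of `E` (inclusion `α`) and a conical contraction
`ψ : CD → D`, the pushout `Ē` of `ψ` along `Cα : CD → CE` carries an induced conical
contraction, and the composite `β : E → CE → Ē` of the unit with the structure map is
injective in each degree.  (Maps out of a reduced cone `CX` are given by maps out of the
unreduced cone `ĈX` which are constant on the `coneRel`-classes; `Ē` is presented by its
degreewise pushout universal property.) -/
theorem enlargement_of_conical_contraction
    (D E : BSSet) (alpha : ∀ n, D.X n → E.X n)
    (hinj : ∀ n, Function.Injective (alpha n))
    (hpt : ∀ n, alpha n (D.pt n) = E.pt n)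
    (hd : ∀ j n, j ≤ n + 1 → ∀ x, alpha n (D.d j n x) = E.d j n (alpha (n + 1) x))
    (hs : ∀ j n, j ≤ n → ∀ x, alpha (n + 1) (D.s j n x) = E.s j n (alpha n x))
    (psi : ∀ n, hatC D.X n → D.X n)
    (hpsinone : ∀ n, psi n none = D.pt n)
    (hpsibase : ∀ n (i : Fin (n + 1)), psi n (some ⟨i, D.pt _⟩) = D.pt n)
    (hpsiunit : ∀ n x, psi n (hatEta D.X n x) = x)
    (hpsid : ∀ j n, j ≤ n + 1 → ∀ z, psi n (hatD D.X D.d j n z) = D.d j n (psi (n + 1) z))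
    (hpsis : ∀ j n, j ≤ n → ∀ z, psi (n + 1) (hatS D.X D.s j n z) = D.s j n (psi n z))
    (hpsiconical : ∀ n (z : hatC (fun m => hatC D.X m) n),
      psi n (hatMap (fun m => psi m) n z) = psi n (hatMu D.X n z)) :
    ∃ (Eb : BSSet) (i1 : ∀ n, D.X n → Eb.X n) (i2 : ∀ n, hatC E.X n → Eb.X n),
      (∀ j n, j ≤ n + 1 → ∀ x, i1 n (D.d j n x) = Eb.d j n (i1 (n + 1) x)) ∧
      (∀ j n, j ≤ n → ∀ x, i1 (n + 1) (D.s j n x) = Eb.s j n (i1 n x)) ∧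
      (∀ n, i1 n (D.pt n) = Eb.pt n) ∧
      (∀ n a b, coneRel E.X E.pt n a b → i2 n a = i2 n b) ∧
      (∀ n, i2 n none = Eb.pt n) ∧
      (∀ j n, j ≤ n + 1 → ∀ z, i2 n (hatD E.X E.d j n z) = Eb.d j n (i2 (n + 1) z)) ∧
      (∀ j n, j ≤ n → ∀ z, i2 (n + 1) (hatS E.X E.s j n z) = Eb.s j n (i2 n z)) ∧
      (∀ n (z : hatC D.X n), i2 n (hatMap alpha n z) = i1 n (psi n z)) ∧
      (∀ (Z : ℕ → Type) (f : ∀ n, D.X n → Z n) (g : ∀ n, hatC E.X n → Z n),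
        (∀ n a b, coneRel E.X E.pt n a b → g n a = g n b) →
        (∀ n (z : hatC D.X n), g n (hatMap alpha n z) = f n (psi n z)) →
        ∀ n, ExistsUnique (fun h : Eb.X n → Z n =>
          (∀ x, h (i1 n x) = f n x) ∧ (∀ w, h (i2 n w) = g n w))) ∧
      (∀ n, Function.Injective (fun x : E.X n => i2 n (hatEta E.X n x))) ∧
      (∃ psib : ∀ n, hatC Eb.X n → Eb.X n,
        (∀ n, psib n none = Eb.pt n) ∧
        (∀ n (i : Fin (n + 1)), psib n (some ⟨i, Eb.pt _⟩) = Eb.pt n) ∧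
        (∀ n x, psib n (hatEta Eb.X n x) = x) ∧
        (∀ j n, j ≤ n + 1 → ∀ z,
          psib n (hatD Eb.X Eb.d j n z) = Eb.d j n (psib (n + 1) z)) ∧
        (∀ j n, j ≤ n → ∀ z,
          psib (n + 1) (hatS Eb.X Eb.s j n z) = Eb.s j n (psib n z)) ∧
        (∀ n (z : hatC (fun m => hatC Eb.X m) n),
          psib n (hatMap (fun m => psib m) n z) = psib n (hatMu Eb.X n z)) ∧
        (∀ n (z : hatC E.X n),
          psib n (hatMap (fun m x => i2 m (hatEta E.X m x)) n z) = i2 n z)) := by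
  let S : ContractedSubset D E := ⟨alpha, hinj, hpt, hd, hs, psi, hpsinone, hpsibase,
    hpsiunit, hpsid, hpsis, hpsiconical⟩
  refine ⟨S.enlargement, S.ofSubset, S.ofCone,
    fun j n hj x => (S.face_ofSubset hj x).symm,
    fun j n hj x => (S.degen_ofSubset hj x).symm,
    fun n => rfl,
    fun n a b h => S.ofCone_eq_of_coneRel h,
    S.ofCone_none,
    fun j n hj w => (S.face_ofCone hj w).symm,
    fun j n hj w => (S.degen_ofCone hj w).symm,
    S.ofCone_hatMap, ?_, S.ofCone_hatEta_injective,
    S.contraction, S.contraction_none, ?_, S.contraction_hatEta,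
    fun j n hj z => S.contraction_hatD hj z,
    fun j n hj z => S.contraction_hatS hj z,
    S.contraction_conical, S.contraction_hatMap_ofCone_hatEta⟩
  · intro Z f g _ hfg n
    refine ⟨S.desc (f n) (g n) (hfg n), ⟨fun x => rfl, fun w => rfl⟩, ?_⟩
    rintro h ⟨h1, h2⟩
    funext q
    rcases S.simplex_cases q with ⟨x, rfl⟩ | ⟨w, rfl⟩
    · exact h1 x
    · exact h2 w
  · exact fun n i => congrArg (S.ofSubset n) (hpsibase n i)
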